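/- Assume q = p is prime. Let d, N ≥ 1 and k = (k_0,…,k_{d−1}) ∈ ℕ^d with |k̄| ≤ ℓ_p(N). Then U_d(N, k̄) contains a unique optimal element, and it equals the greedy element of U_d(N, k̄). Moreover, for any k ∈ ℕ^d, the polynomial Σ_{a∈A_{+,d}} a(t)^N·a^{k} ∈ 𝔽_p[t] is nonzero if and only if |k̄| ≤ ℓ_p(N). -/

import Mathlib

noncomputable section

/-- `U_d(N,k)`: tuples `m = (m_0,…,m_d) ∈ ℕ^{d+1}` with `m_0 + ⋯ + m_d = N`, no carryover
of `p`-digits in this sum (i.e. `ℓ_p(N) = Σ_n ℓ_p(m_n)`), and `m_n - k_n ∈ (p-1)ℕ` for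
`n = 0,…,d-1`. -/
def Ud (p d N : ℕ) (k : Fin d → ℕ) : Set (Fin (d + 1) → ℕ) :=
  {m | (∑ n : Fin (d + 1), m n) = N ∧
    (Nat.digits p N).sum = ∑ n : Fin (d + 1), (Nat.digits p (m n)).sum ∧
    ∀ n : Fin d, ∃ c : ℕ, m n.castSucc = k n + (p - 1) * c}

/-- `deg m = m_1 + 2m_2 + ⋯ + d·m_d`. -/
def degU {d : ℕ} (m : Fin (d + 1) → ℕ) : ℕ :=
  ∑ n : Fin (d + 1), (n : ℕ) * m n

/-- `m' ≤ m` for the lexicographic order on the reversed tuples `(m_d, m_{d-1}, …)`. -/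
def RevLexLe {d : ℕ} (m' m : Fin (d + 1) → ℕ) : Prop :=
  m' = m ∨ ∃ i : Fin (d + 1),
    (∀ j : Fin (d + 1), j < i → m' (Fin.rev j) = m (Fin.rev j)) ∧
      m' (Fin.rev i) < m (Fin.rev i)

/-- `m` is the greedy element of `U_d(N,k)`: it belongs to `U_d(N,k)` and its reversed
tuple is lexicographically largest. -/
def IsGreedyU (p d N : ℕ) (k : Fin d → ℕ) (m : Fin (d + 1) → ℕ) : Prop :=
  m ∈ Ud p d N k ∧ ∀ m' ∈ Ud p d N k, RevLexLe m' m

end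

noncomputable section

open Polynomial

/-- The monic polynomial of degree `d` in `θ` with lower-order coefficients `c`;
as `c` runs through `Fin d → 𝔽_p` this runs through `A_{+,d}`. -/
def monicOfDeg (p : ℕ) [Fact p.Prime] (d : ℕ) (c : Fin d → ZMod p) : Polynomial (ZMod p) :=
  X ^ d + ∑ i : Fin d, C (c i) * X ^ (i : ℕ)

section DigitSum

variable {p : ℕ}

lemma digits_sum_eq_mod_add_div (hp : 1 < p) (n : ℕ) :
    (p.digits n).sum = n % p + (p.digits (n / p)).sum := by
  rcases Nat.eq_zero_or_pos n with rfl | hn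
  · simp
  · rw [Nat.digits_def' hp hn, List.sum_cons]

lemma digits_sum_add_mul (hp : 1 < p) {r : ℕ} (hr : r < p) (n : ℕ) :
    (p.digits (r + p * n)).sum = r + (p.digits n).sum := by
  rw [digits_sum_eq_mod_add_div hp, Nat.add_mul_mod_self_left, Nat.mod_eq_of_lt hr,
    Nat.add_mul_div_left _ _ (by lia), Nat.div_eq_of_lt hr, zero_add]

lemma digits_sum_of_lt (hp : 1 < p) {r : ℕ} (hr : r < p) : (p.digits r).sum = r := by
  simpa using digits_sum_add_mul hp hr 0

lemma digits_sum_eq_zero (hp : 1 < p) {n : ℕ} (h : (p.digits n).sum = 0) : n = 0 := by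
  induction n using Nat.strong_induction_on with
  | _ n ih =>
    rw [digits_sum_eq_mod_add_div hp] at h
    by_contra hn
    have hdiv := ih (n / p) (Nat.div_lt_self (by lia) hp) (by lia)
    have hmod := Nat.mod_add_div n p
    rw [hdiv] at hmod
    lia

/-- Legendre's formula for factorials, without subtraction. -/
lemma digits_sum_add_eq [Fact p.Prime] (n : ℕ) :
    (p.digits n).sum + (p - 1) * padicValNat p n.factorial = n := by
  have := Nat.digit_sum_le p n
  rw [sub_one_mul_padicValNat_factorial]
  lia

/-- Legendre's formula for multinomial coefficients. -/
lemma sum_digits_sum_eq [Fact p.Prime] {ι : Type*} (s : Finset ι) (f : ι → ℕ) :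
    ∑ i ∈ s, (p.digits (f i)).sum =
      (p.digits (∑ i ∈ s, f i)).sum + (p - 1) * padicValNat p (Nat.multinomial s f) := by
  have hval : padicValNat p (∏ i ∈ s, (f i).factorial) =
      ∑ i ∈ s, padicValNat p (f i).factorial := by
    classical
    induction s using Finset.induction_on with
    | empty => simp
    | insert a s ha ih =>
      rw [Finset.prod_insert ha, Finset.sum_insert ha, padicValNat.mul (Nat.factorial_ne_zero _)
        (Finset.prod_ne_zero_iff.2 fun i _ => Nat.factorial_ne_zero _), ih]
  have hspec := congrArg (fun n => (p - 1) * padicValNat p n) (Nat.multinomial_spec s f)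
  rw [padicValNat.mul (Finset.prod_ne_zero_iff.2 fun i _ => Nat.factorial_ne_zero _)
    (Nat.multinomial_pos s f).ne', hval, mul_add, Finset.mul_sum] at hspec
  have hsum : ∑ i ∈ s, f i = ∑ i ∈ s, (p.digits (f i)).sum +
      ∑ i ∈ s, (p - 1) * padicValNat p (f i).factorial := by
    rw [← Finset.sum_add_distrib]
    exact Finset.sum_congr rfl fun i _ => (digits_sum_add_eq _).symm
  have := digits_sum_add_eq (p := p) (∑ i ∈ s, f i)
  lia

lemma digits_sum_sum_le [Fact p.Prime] {ι : Type*} (s : Finset ι) (f : ι → ℕ) :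
    (p.digits (∑ i ∈ s, f i)).sum ≤ ∑ i ∈ s, (p.digits (f i)).sum :=
  (sum_digits_sum_eq (p := p) s f).symm ▸ Nat.le_add_right _ _

lemma digits_sum_add_le [Fact p.Prime] (a b : ℕ) :
    (p.digits (a + b)).sum ≤ (p.digits a).sum + (p.digits b).sum := by
  simpa using digits_sum_sum_le (p := p) Finset.univ ![a, b]

lemma multinomial_cast_ne_zero_iff [hp : Fact p.Prime] {ι : Type*} (s : Finset ι) (f : ι → ℕ) :
    (Nat.multinomial s f : ZMod p) ≠ 0 ↔
      (p.digits (∑ i ∈ s, f i)).sum = ∑ i ∈ s, (p.digits (f i)).sum := by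
  have hp1 := hp.out.one_lt
  have hpos := Nat.multinomial_pos s f
  rw [sum_digits_sum_eq, left_eq_add, Nat.mul_eq_zero, padicValNat.eq_zero_iff, Ne,
    ZMod.natCast_eq_zero_iff]
  have := hp.out.ne_one
  lia

/-- A sum without carry restricts to a sum without carry of the quotients by `p`. -/
lemma mod_add_mod_and_digits_sum_div [hp : Fact p.Prime] {a b : ℕ}
    (h : (p.digits a).sum + (p.digits b).sum = (p.digits (a + b)).sum) :
    a % p + b % p = (a + b) % p ∧ a / p + b / p = (a + b) / p ∧
      (p.digits (a / p)).sum + (p.digits (b / p)).sum = (p.digits ((a + b) / p)).sum := by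
  have hp1 := hp.out.one_lt
  rw [digits_sum_eq_mod_add_div hp1 a, digits_sum_eq_mod_add_div hp1 b,
    digits_sum_eq_mod_add_div hp1 (a + b)] at h
  have ha := Nat.mod_lt a (by lia : 0 < p)
  have hb := Nat.mod_lt b (by lia : 0 < p)
  rcases lt_or_ge (a % p + b % p) p with hlt | hge
  · have hmod : (a + b) % p = a % p + b % p := by rw [Nat.add_mod, Nat.mod_eq_of_lt hlt]
    have hdiv : (a + b) / p = a / p + b / p := by
      rw [Nat.add_div (by lia), if_neg (by lia), add_zero]
    rw [hdiv, hmod] at h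
    exact ⟨hmod.symm, hdiv.symm, by rw [hdiv]; lia⟩
  · have hmod : (a + b) % p = a % p + b % p - p := by
      rw [Nat.add_mod, Nat.mod_eq_sub_mod hge, Nat.mod_eq_of_lt (by lia)]
    have hdiv : (a + b) / p = a / p + b / p + 1 := by
      rw [Nat.add_div (by lia), if_pos hge]
    have h₁ := digits_sum_add_le (p := p) (a / p + b / p) 1
    have h₂ := digits_sum_add_le (p := p) (a / p) (b / p)
    rw [digits_sum_of_lt hp1 hp1] at h₁
    rw [hdiv, hmod] at h
    lia

/-- Write `N` as a sum of `ℓ_p(N)` powers of `p`, in nondecreasing order.  The partial sums `f K`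
are the smallest numbers of digit sum at least `K` that can be subtracted from `N` without
borrowing. -/
lemma exists_minimal_partial_sums [hp : Fact p.Prime] (N : ℕ) :
    ∃ f : ℕ → ℕ, f 0 = 0 ∧ f (p.digits N).sum = N ∧
      (∀ K L, K ≤ L → L ≤ (p.digits N).sum →
        ∃ x, f L = f K + x ∧ (p.digits x).sum + K = L) ∧
      ∀ K T S, T + S = N → (p.digits T).sum + (p.digits S).sum = (p.digits N).sum →
        K ≤ (p.digits T).sum → f K ≤ T := by
  have hp1 := hp.out.one_lt
  induction N using Nat.strong_induction_on with
  | _ N ih =>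
  rcases Nat.eq_zero_or_pos N with rfl | hN
  · refine ⟨fun _ => 0, rfl, rfl, fun K L hKL hL => ⟨0, rfl, ?_⟩, fun K T S _ _ _ => Nat.zero_le _⟩
    simp at hL ⊢
    lia
  obtain ⟨f, hf0, hfN, hfdiff, hfmin⟩ := ih (N / p) (Nat.div_lt_self hN hp1)
  have hsN := digits_sum_eq_mod_add_div hp1 N
  have hmod := Nat.mod_lt N (by lia : 0 < p)
  refine ⟨fun K => if K ≤ N % p then K else N % p + p * f (K - N % p), by simp, ?_, ?_, ?_⟩
  · dsimp only
    split_ifs with h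
    · have hz : N / p = 0 := digits_sum_eq_zero hp1 (by lia)
      have := Nat.mod_add_div N p
      rw [hz] at this hsN
      simp at this hsN
      lia
    · rw [hsN, Nat.add_sub_cancel_left, hfN, Nat.mod_add_div]
  · intro K L hKL hL
    dsimp only
    by_cases hL' : L ≤ N % p
    · rw [if_pos hL', if_pos (by lia)]
      exact ⟨L - K, by lia, by rw [digits_sum_of_lt hp1 (by lia)]; lia⟩
    · rw [if_neg hL']
      by_cases hK : K ≤ N % p
      · obtain ⟨x, hx, hxs⟩ := hfdiff 0 (L - N % p) (by lia) (by lia)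
        refine ⟨(N % p - K) + p * x, ?_, ?_⟩
        · rw [if_pos hK, hx, hf0, zero_add]
          lia
        · rw [digits_sum_add_mul hp1 (by lia)]
          lia
      · obtain ⟨x, hx, hxs⟩ := hfdiff (K - N % p) (L - N % p) (by lia) (by lia)
        refine ⟨0 + p * x, ?_, ?_⟩
        · rw [if_neg hK, hx]
          ring
        · rw [digits_sum_add_mul hp1 (by lia)]
          lia
  · intro K T S hTS hs hK
    dsimp only
    split_ifs with h
    · exact hK.trans (Nat.digit_sum_le p T)
    · subst hTS
      obtain ⟨hm, hd, hs'⟩ := mod_add_mod_and_digits_sum_div hs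
      have hsT := digits_sum_eq_mod_add_div hp1 T
      have hT := Nat.mod_add_div T p
      rcases Nat.eq_or_lt_of_le (by lia : T % p ≤ (T + S) % p) with heq | hlt
      · have := hfmin (K - (T + S) % p) (T / p) (S / p) hd hs' (by lia)
        have := Nat.mul_le_mul_left p this
        lia
      · have hle := hfmin (K - (T + S) % p + 1) (T / p) (S / p) hd hs' (by lia)
        obtain ⟨x, hx, hxs⟩ := hfdiff (K - (T + S) % p) (K - (T + S) % p + 1) (by lia) (by lia)
        have hx0 : x ≠ 0 := by
          rintro rfl
          simp at hxs
        have := Nat.mul_le_mul_left p (by lia : f (K - (T + S) % p) + 1 ≤ T / p)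
        lia

end DigitSum

section Tuples

variable {p d N : ℕ}

/-- The partial sum `m_0 + ⋯ + m_{j-1}`. -/
def partialSum (m : Fin (d + 1) → ℕ) (j : ℕ) : ℕ :=
  ∑ i ∈ {i : Fin (d + 1) | (i : ℕ) < j}, m i

lemma partialSum_zero (m : Fin (d + 1) → ℕ) : partialSum m 0 = 0 := by
  simp [partialSum]

lemma partialSum_succ (m : Fin (d + 1) → ℕ) (n : Fin (d + 1)) :
    partialSum m (n + 1) = partialSum m n + m n := by
  have h : ({i : Fin (d + 1) | (i : ℕ) < n + 1} : Finset (Fin (d + 1))) =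
      insert n ({i : Fin (d + 1) | (i : ℕ) < n} : Finset (Fin (d + 1))) := by
    ext i
    simp [Fin.ext_iff]
    lia
  rw [partialSum, h, Finset.sum_insert (by simp), add_comm, partialSum]

lemma partialSum_last (m : Fin (d + 1) → ℕ) : partialSum m (d + 1) = ∑ i, m i := by
  rw [partialSum, Finset.filter_true_of_mem fun i _ => i.is_lt]

lemma partialSum_eq_of_forall_eq_add {m : Fin (d + 1) → ℕ} {g : ℕ → ℕ} (h0 : g 0 = 0)
    (h : ∀ n : Fin (d + 1), g (n + 1) = g n + m n) {j : ℕ} (hj : j ≤ d + 1) :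
    partialSum m j = g j := by
  induction j with
  | zero => rw [partialSum_zero, h0]
  | succ j ih =>
    have h₁ := partialSum_succ m ⟨j, hj⟩
    have h₂ := h ⟨j, hj⟩
    have h₃ := ih (by lia)
    simp only at h₁ h₂
    lia

lemma eq_of_partialSum_eq {m m' : Fin (d + 1) → ℕ}
    (h : ∀ j ≤ d + 1, partialSum m j = partialSum m' j) : m = m' := by
  funext n
  have h₁ := partialSum_succ m n
  have h₂ := partialSum_succ m' n
  rw [h _ (by lia), h _ (by lia)] at h₁
  lia

lemma degU_add_sum_partialSum (m : Fin (d + 1) → ℕ) :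
    degU m + ∑ j ∈ Finset.range (d + 1), partialSum m j = d * ∑ i, m i := by
  have h : ∑ j ∈ Finset.range (d + 1), partialSum m j = ∑ i : Fin (d + 1), (d - i) * m i := by
    simp only [partialSum, Finset.sum_filter]
    rw [Finset.sum_comm]
    refine Finset.sum_congr rfl fun i _ => ?_
    rw [← Finset.sum_filter, Finset.sum_const, smul_eq_mul]
    congr 1
    have : (Finset.range (d + 1)).filter (fun j => (i : ℕ) < j) = Finset.Ioc (i : ℕ) d := by
      ext j
      simp
      lia
    rw [this, Nat.card_Ioc]
  rw [h, degU, ← Finset.sum_add_distrib, Finset.mul_sum]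
  refine Finset.sum_congr rfl fun i _ => ?_
  rw [← add_mul, Nat.add_sub_cancel' (by lia)]

lemma degU_le_of_partialSum_le {m m' : Fin (d + 1) → ℕ} (hsum : ∑ i, m' i = ∑ i, m i)
    (h : ∀ j ≤ d, partialSum m j ≤ partialSum m' j) : degU m' ≤ degU m := by
  have h₁ := degU_add_sum_partialSum m
  have h₂ := degU_add_sum_partialSum m'
  have h₃ : ∑ j ∈ Finset.range (d + 1), partialSum m j ≤
      ∑ j ∈ Finset.range (d + 1), partialSum m' j :=
    Finset.sum_le_sum fun j hj => h j (by simp at hj; lia)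
  rw [hsum] at h₂
  lia

lemma eq_of_partialSum_le_of_degU_eq {m m' : Fin (d + 1) → ℕ} (hsum : ∑ i, m' i = ∑ i, m i)
    (h : ∀ j ≤ d, partialSum m j ≤ partialSum m' j) (hdeg : degU m' = degU m) : m' = m := by
  have h₁ := degU_add_sum_partialSum m
  have h₂ := degU_add_sum_partialSum m'
  rw [hsum] at h₂
  have heq := (Finset.sum_eq_sum_iff_of_le (s := Finset.range (d + 1))
    fun j hj => h j (by simp at hj; lia)).1 (by lia)
  refine eq_of_partialSum_eq fun j hj => ?_
  rcases Nat.eq_or_lt_of_le hj with rfl | hlt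
  · rw [partialSum_last, partialSum_last, hsum]
  · exact (heq j (by simpa using hlt)).symm

lemma revLexLe_of_partialSum_le {m m' : Fin (d + 1) → ℕ} (hsum : ∑ i, m' i = ∑ i, m i)
    (h : ∀ j ≤ d, partialSum m j ≤ partialSum m' j) : RevLexLe m' m := by
  by_cases hne : m' = m
  · exact Or.inl hne
  obtain ⟨a, ha⟩ := Function.ne_iff.1 hne
  obtain ⟨n, hn, hmax⟩ := Finset.exists_max_image
    (Finset.univ.filter fun i => m' i ≠ m i) id ⟨a, by simpa using ha⟩
  simp only [Finset.mem_filter, Finset.mem_univ, true_and, id] at hn hmax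
  have habove : ∀ i, n < i → m' i = m i := fun i hi => by
    by_contra hcon
    exact absurd (hmax i hcon) (not_le.2 hi)
  refine Or.inr ⟨n.rev, fun j hj => habove _ (by simpa [Fin.lt_rev_iff] using hj), ?_⟩
  rw [Fin.rev_rev]
  have hsplit (f : Fin (d + 1) → ℕ) :
      partialSum f (n + 1) + ∑ i ∈ {i : Fin (d + 1) | ¬ (i : ℕ) < n + 1}, f i = ∑ i, f i :=
    Finset.sum_filter_add_sum_filter_not _ _ _
  have htail : ∑ i ∈ {i : Fin (d + 1) | ¬ (i : ℕ) < n + 1}, m' i =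
      ∑ i ∈ {i : Fin (d + 1) | ¬ (i : ℕ) < n + 1}, m i :=
    Finset.sum_congr rfl fun i hi => habove i (by
      simp only [Finset.mem_filter, Finset.mem_univ, true_and] at hi
      lia)
  have h₁ := hsplit m
  have h₂ := hsplit m'
  have h₃ := h n (by lia)
  rw [partialSum_succ] at h₁ h₂
  lia

lemma le_digits_sum_of_eq_add [hp : Fact p.Prime] {k m c : ℕ} (hk : k ≤ p - 1)
    (h : m = k + (p - 1) * c) : k ≤ (p.digits m).sum := by
  have hp1 := hp.out.one_lt
  by_contra! hlt
  have hm := digits_sum_add_eq (p := p) m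
  have hdvd : p - 1 ∣ k - (p.digits m).sum := by
    rw [Nat.dvd_add_iff_left (n := (p - 1) * c) (Dvd.intro c rfl)]
    exact ⟨padicValNat p m.factorial, by lia⟩
  have hle := Nat.le_of_dvd (by lia) hdvd
  have := digits_sum_eq_zero hp1 (n := m) (by lia)
  lia

/-- The initial segments of an element of `U_d(N,k)` are summed without carry. -/
lemma digits_sum_partialSum [hp : Fact p.Prime] {k : Fin d → ℕ} {m : Fin (d + 1) → ℕ}
    (hm : m ∈ Ud p d N k) (j : ℕ) :
    (p.digits (partialSum m j)).sum + (p.digits (N - partialSum m j)).sum = (p.digits N).sum ∧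
      partialSum m j ≤ N ∧
      (p.digits (partialSum m j)).sum =
        ∑ i ∈ {i : Fin (d + 1) | (i : ℕ) < j}, (p.digits (m i)).sum := by
  obtain ⟨hsum, hdig, -⟩ := hm
  have h₁ : partialSum m j + ∑ i ∈ {i : Fin (d + 1) | ¬ (i : ℕ) < j}, m i = N := by
    rw [← hsum]
    exact Finset.sum_filter_add_sum_filter_not _ _ _
  have h₂ := Finset.sum_filter_add_sum_filter_not Finset.univ
    (fun i : Fin (d + 1) => (i : ℕ) < j) (fun i => (p.digits (m i)).sum)
  have h₃ := digits_sum_sum_le (p := p)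
    (Finset.univ.filter fun i : Fin (d + 1) => (i : ℕ) < j) m
  have h₄ := digits_sum_sum_le (p := p)
    (Finset.univ.filter fun i : Fin (d + 1) => ¬ (i : ℕ) < j) m
  have h₅ := digits_sum_add_le (p := p) (partialSum m j)
    (∑ i ∈ {i : Fin (d + 1) | ¬ (i : ℕ) < j}, m i)
  rw [h₁] at h₅
  rw [show N - partialSum m j = ∑ i ∈ {i : Fin (d + 1) | ¬ (i : ℕ) < j}, m i by lia]
  change (p.digits (partialSum m j)).sum ≤ _ at h₃
  exact ⟨by lia, by lia, by lia⟩

lemma sum_le_digits_sum_partialSum [hp : Fact p.Prime] {k : Fin d → ℕ} (hk : ∀ n, k n ≤ p - 1)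
    {m : Fin (d + 1) → ℕ} (hm : m ∈ Ud p d N k) (j : ℕ) :
    ∑ i ∈ {i : Fin d | (i : ℕ) < j}, k i ≤ (p.digits (partialSum m j)).sum := by
  rw [(digits_sum_partialSum hm j).2.2, Finset.sum_filter, Finset.sum_filter,
    Fin.sum_univ_castSucc]
  refine le_trans (Finset.sum_le_sum fun i _ => ?_) (Nat.le_add_right _ _)
  simp only [Fin.val_castSucc]
  split_ifs
  · obtain ⟨c, hc⟩ := hm.2.2 i
    exact le_digits_sum_of_eq_add (hk i) hc
  · exact le_rfl

lemma sum_le_digits_sum_of_mem [hp : Fact p.Prime] {k : Fin d → ℕ} (hk : ∀ n, k n ≤ p - 1)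
    {m : Fin (d + 1) → ℕ} (hm : m ∈ Ud p d N k) : ∑ n, k n ≤ (p.digits N).sum := by
  have h₁ := sum_le_digits_sum_partialSum hk hm (d + 1)
  rw [partialSum_last, hm.1, Finset.filter_true_of_mem fun i _ => by lia] at h₁
  exact h₁

/-- Some element of `U_d(N,k)` has all its partial sums minimal. -/
lemma exists_mem_partialSum_le [hp : Fact p.Prime] {k : Fin d → ℕ} (hk : ∀ n, k n ≤ p - 1)
    (hle : ∑ n, k n ≤ (p.digits N).sum) :
    ∃ m ∈ Ud p d N k, ∀ m' ∈ Ud p d N k, ∀ j ≤ d, partialSum m j ≤ partialSum m' j := by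
  obtain ⟨f, hf0, hfN, hfdiff, hfmin⟩ := exists_minimal_partial_sums (p := p) N
  let K : ℕ → ℕ := fun j =>
    if j ≤ d then ∑ i ∈ {i : Fin d | (i : ℕ) < j}, k i else (p.digits N).sum
  have hK0 : K 0 = 0 := by simp [K]
  have hKlast : K (d + 1) = (p.digits N).sum := by simp [K]
  have hKd : K d = ∑ n, k n := by simp [K]
  have hKsucc (n : Fin d) : K (n + 1) = K n + k n := by
    have h : ({i : Fin d | (i : ℕ) < n + 1} : Finset (Fin d)) =
        insert n ({i : Fin d | (i : ℕ) < n} : Finset (Fin d)) := by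
      ext i
      simp [Fin.ext_iff]
      lia
    simp only [K]
    rw [if_pos (by lia), if_pos (by lia), h, Finset.sum_insert (by simp), add_comm]
  have hKle (j : ℕ) : K j ≤ (p.digits N).sum := by
    simp only [K]
    split_ifs
    · exact (Finset.sum_le_sum_of_subset (Finset.filter_subset _ _)).trans hle
    · exact le_rfl
  have hKmono (n : Fin (d + 1)) : K n ≤ K (n + 1) := by
    induction n using Fin.lastCases with
    | last => simpa [hKlast] using hKle d
    | cast n => simp [hKsucc n]
  choose m hm hms using fun n : Fin (d + 1) => hfdiff (K n) (K (n + 1)) (hKmono n) (hKle _)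
  have hpart {j : ℕ} (hj : j ≤ d + 1) : partialSum m j = f (K j) :=
    partialSum_eq_of_forall_eq_add (g := fun j => f (K j)) (by simp [hK0, hf0]) hm hj
  have hpartdig : partialSum (fun n => (p.digits (m n)).sum) (d + 1) = K (d + 1) :=
    partialSum_eq_of_forall_eq_add hK0 (fun n => by rw [← hms n, add_comm]) le_rfl
  refine ⟨m, ⟨?_, ?_, fun n => ?_⟩, fun m' hm' j hj => ?_⟩
  · rw [← partialSum_last, hpart le_rfl, hKlast, hfN]
  · rw [← hKlast, ← hpartdig, partialSum_last]
  · have h₁ := hms n.castSucc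
    have h₂ := hKsucc n
    have h₃ := digits_sum_add_eq (p := p) (m n.castSucc)
    simp only [Fin.val_castSucc] at h₁
    exact ⟨_, by rw [show k n = (p.digits (m n.castSucc)).sum by lia]; exact h₃.symm⟩
  · obtain ⟨h₁, h₂, -⟩ := digits_sum_partialSum hm' j
    rw [hpart (by lia)]
    refine hfmin _ _ (N - partialSum m' j) (by lia) h₁ ?_
    simpa only [K, if_pos hj] using sum_le_digits_sum_partialSum hk hm' j

end Tuples

section PowerSums

variable {p : ℕ} [hp : Fact p.Prime]

lemma sum_zmod_pow (i : ℕ) :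
    ∑ x : ZMod p, x ^ i = if p - 1 ∣ i ∧ 0 < i then -1 else 0 := by
  rcases Nat.eq_zero_or_pos i with rfl | hi
  · simp
  · have hunits := FiniteField.sum_pow_units (ZMod p) i
    rw [ZMod.card] at hunits
    simp only [hi, and_true]
    rw [← hunits, ← Finset.sum_sdiff (Finset.subset_univ {(0 : ZMod p)}), Finset.sum_singleton,
      zero_pow hi.ne', add_zero]
    symm
    refine Finset.sum_bij (fun x _ => (x : ZMod p)) (by simp) (by simp [Units.ext_iff]) ?_ (by simp)
    intro b hb
    exact ⟨Units.mk0 b (by simpa using hb), by simp⟩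

lemma monicOfDeg_eq_sum (d : ℕ) (c : Fin d → ZMod p) :
    monicOfDeg p d c =
      ∑ i : Fin (d + 1), C (Fin.snoc (α := fun _ => ZMod p) c 1 i) * X ^ (i : ℕ) := by
  rw [monicOfDeg, Fin.sum_univ_castSucc]
  simp [add_comm]

lemma sum_smul_monicOfDeg_pow (d N : ℕ) (k : Fin d → ℕ) :
    ∑ c : Fin d → ZMod p, (∏ n : Fin d, c n ^ k n) • monicOfDeg p d c ^ N =
      ∑ m ∈ Finset.piAntidiag (Finset.univ : Finset (Fin (d + 1))) N,
        C ((Nat.multinomial Finset.univ m : ZMod p) *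
          ∏ n : Fin d, ∑ x : ZMod p, x ^ (k n + m n.castSucc)) * X ^ degU m := by
  simp only [monicOfDeg_eq_sum, Finset.sum_pow_eq_sum_piAntidiag, Finset.smul_sum]
  rw [Finset.sum_comm]
  refine Finset.sum_congr rfl fun m _ => ?_
  rw [Finset.prod_univ_sum, Fintype.piFinset_univ, Finset.mul_sum, map_sum, Finset.sum_mul]
  refine Finset.sum_congr rfl fun c _ => ?_
  have hX : ∏ i : Fin (d + 1), (X ^ (i : ℕ) : (ZMod p)[X]) ^ m i = X ^ degU m := by
    simp only [← pow_mul]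
    rw [Finset.prod_pow_eq_pow_sum, degU]
  simp only [mul_pow, Finset.prod_mul_distrib, hX, smul_eq_C_mul, pow_add, map_mul, map_prod,
    map_pow, map_natCast]
  rw [Fin.prod_univ_castSucc]
  simp
  ring

/-- The tuples with nonzero contribution to `Σ_a a(t)^N a^k` are the elements of `U_d(N,k̄)`. -/
lemma multinomial_mul_prod_sum_pow_ne_zero_iff {d N : ℕ} {k kbar : Fin d → ℕ}
    (hkbar : ∀ n : Fin d, kbar n ≤ p - 1 ∧ (p - 1) ∣ (k n + kbar n) ∧ 0 < k n + kbar n ∧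
      ∀ j : ℕ, j ≤ p - 1 → (p - 1) ∣ (k n + j) → 0 < k n + j → kbar n ≤ j)
    {m : Fin (d + 1) → ℕ} (hm : ∑ n, m n = N) :
    (Nat.multinomial Finset.univ m : ZMod p) *
      ∏ n : Fin d, ∑ x : ZMod p, x ^ (k n + m n.castSucc) ≠ 0 ↔ m ∈ Ud p d N kbar := by
  have hcond (n : Fin d) : ∑ x : ZMod p, x ^ (k n + m n.castSucc) ≠ 0 ↔
      ∃ c : ℕ, m n.castSucc = kbar n + (p - 1) * c := by
    obtain ⟨hle, hdvd, hpos, hmin⟩ := hkbar n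
    have hiff : ∑ x : ZMod p, x ^ (k n + m n.castSucc) ≠ 0 ↔
        p - 1 ∣ k n + m n.castSucc ∧ 0 < k n + m n.castSucc := by
      rw [sum_zmod_pow, Ne, ite_eq_right_iff]
      simp only [neg_eq_zero, one_ne_zero, imp_false, not_not]
    rw [hiff]
    constructor
    · rintro ⟨h₁, h₂⟩
      have hge : kbar n ≤ m n.castSucc := by
        rcases le_total (m n.castSucc) (p - 1) with h | h
        · exact hmin _ h h₁ h₂
        · exact hle.trans h
      obtain ⟨c, hc⟩ := Nat.dvd_sub h₁ hdvd
      exact ⟨c, by lia⟩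
    · rintro ⟨c, hc⟩
      rw [hc, ← add_assoc]
      exact ⟨hdvd.add (Dvd.intro c rfl), by lia⟩
  rw [mul_ne_zero_iff, multinomial_cast_ne_zero_iff, Finset.prod_ne_zero_iff, hm]
  simp only [Finset.mem_univ, true_imp_iff, hcond]
  exact ⟨fun h => ⟨hm, h⟩, fun h => h.2⟩

end PowerSums

/-- Let `q = p` be prime, `d, N ≥ 1` and `k ∈ ℕ^d`, and let `k̄ ∈ {0,…,p-1}^d` be defined
by: `k̄_n` is the least integer in `{0,…,p-1}` such that `k_n + k̄_n` is a positive
multiple of `p-1`.  If `|k̄| ≤ ℓ_p(N)`, then `U_d(N,k̄)` contains a unique optimal element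
(an element maximizing `deg`), and this element is the greedy element of `U_d(N,k̄)`.
Moreover `Σ_{a ∈ A_{+,d}} a(t)^N·a^k ≠ 0` if and only if `|k̄| ≤ ℓ_p(N)`. -/
theorem unique_optimal_and_nonvanishing (p : ℕ) [Fact p.Prime] (d N : ℕ)
    (hd : 1 ≤ d) (hN : 1 ≤ N) (k : Fin d → ℕ) (kbar : Fin d → ℕ)
    (hkbar : ∀ n : Fin d, kbar n ≤ p - 1 ∧ (p - 1) ∣ (k n + kbar n) ∧ 0 < k n + kbar n ∧
      ∀ j : ℕ, j ≤ p - 1 → (p - 1) ∣ (k n + j) → 0 < k n + j → kbar n ≤ j) :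
    ((∑ n, kbar n) ≤ (Nat.digits p N).sum →
      ∃ m : Fin (d + 1) → ℕ,
        (m ∈ Ud p d N kbar ∧ ∀ m' ∈ Ud p d N kbar, degU m' ≤ degU m) ∧
        (∀ m' ∈ Ud p d N kbar,
          (∀ m'' ∈ Ud p d N kbar, degU m'' ≤ degU m') → m' = m) ∧
        IsGreedyU p d N kbar m) ∧
    ((∑ c : Fin d → ZMod p,
        (∏ n : Fin d, c n ^ k n) • monicOfDeg p d c ^ N) ≠ 0 ↔
      (∑ n, kbar n) ≤ (Nat.digits p N).sum) := by
  have hk : ∀ n, kbar n ≤ p - 1 := fun n => (hkbar n).1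
  have hopt : (∑ n, kbar n) ≤ (Nat.digits p N).sum →
      ∃ m : Fin (d + 1) → ℕ,
        (m ∈ Ud p d N kbar ∧ ∀ m' ∈ Ud p d N kbar, degU m' ≤ degU m) ∧
        (∀ m' ∈ Ud p d N kbar,
          (∀ m'' ∈ Ud p d N kbar, degU m'' ≤ degU m') → m' = m) ∧
        IsGreedyU p d N kbar m := by
    intro hle
    obtain ⟨m, hm, hmin⟩ := exists_mem_partialSum_le hk hle
    have hsum {m'} (hm' : m' ∈ Ud p d N kbar) : ∑ i, m' i = ∑ i, m i := hm'.1.trans hm.1.symm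
    have hdeg : ∀ m' ∈ Ud p d N kbar, degU m' ≤ degU m := fun m' hm' =>
      degU_le_of_partialSum_le (hsum hm') (hmin m' hm')
    exact ⟨m, ⟨hm, hdeg⟩,
      fun m' hm' h => eq_of_partialSum_le_of_degU_eq (hsum hm') (hmin m' hm')
        (le_antisymm (hdeg m' hm') (h m hm)),
      hm, fun m' hm' => revLexLe_of_partialSum_le (hsum hm') (hmin m' hm')⟩
  refine ⟨hopt, ?_⟩
  rw [sum_smul_monicOfDeg_pow]
  have hcoeff {m : Fin (d + 1) → ℕ}
      (hm : m ∈ Finset.piAntidiag (Finset.univ : Finset (Fin (d + 1))) N) :=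
    multinomial_mul_prod_sum_pow_ne_zero_iff hkbar (Finset.mem_piAntidiag.1 hm).1
  constructor
  · contrapose!
    intro hlt
    refine Finset.sum_eq_zero fun m hm => ?_
    rw [not_not.1 (mt (hcoeff hm).1 fun h => hlt.not_ge (sum_le_digits_sum_of_mem hk h)), C_0,
      zero_mul]
  · intro hle hzero
    obtain ⟨m, ⟨hm, hdeg⟩, huniq, -⟩ := hopt hle
    have hmem : m ∈ Finset.piAntidiag (Finset.univ : Finset (Fin (d + 1))) N := by
      simpa using hm.1
    refine (hcoeff hmem).2 hm ?_
    have h := congrArg (fun f => coeff f (degU m)) hzero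
    simp only [finsetSum_coeff, coeff_C_mul_X_pow, coeff_zero] at h
    rw [Finset.sum_eq_single_of_mem m hmem, if_pos rfl] at h
    · exact h
    · intro m' hm' hne
      rw [ite_eq_right_iff]
      intro heq
      by_contra hcon
      exact hne (huniq m' ((hcoeff hm').1 hcon) fun m'' hm'' => heq ▸ hdeg m'' hm'')

end
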